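/- arXiv:quant-ph/0505036 — 6 statements merged into one kernel-verified Lean document; each statement's English description precedes it below -/
import Mathlib

section
/- Let N be a natural number and let g_1, …, g_N be 2^N × 2^N complex matrices such that each g_k is Hermitian, g_k² = I, the g_k pairwise commute, and for every nonempty subset T ⊆ {1,…,N} the product ∏_{k∈T} g_k has trace zero. Then P := ∏_{k=1}^N (I + g_k)/2 is a rank-one orthogonal projection: there exists a unit vector v ∈ ℂ^{2^N} with P = v v*, with g_k v = v for all k; moreover, every vector w ∈ ℂ^{2^N} satisfying g_k w = w for all k is a scalar multiple of v. -/
open Matrix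

open scoped ComplexOrder in
/-- A Hermitian idempotent matrix of trace one is the projection onto a unit vector. -/
theorem exists_eq_vecMulVec_of_trace_eq_one {n : Type*} [Fintype n] [DecidableEq n]
    {P : Matrix n n ℂ} (hH : P.IsHermitian) (hid : P * P = P) (htr : P.trace = 1) :
    ∃ v : n → ℂ, star v ⬝ᵥ v = 1 ∧ P *ᵥ v = v ∧ P = vecMulVec v (star v) := by
  obtain ⟨v, hv, hPv⟩ : ∃ v : n → ℂ, star v ⬝ᵥ v = 1 ∧ P *ᵥ v = v := by
    obtain ⟨w, hw⟩ : ∃ w, P *ᵥ w ≠ 0 := by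
      by_contra! h
      have : P = 0 := ext_of_mulVec_single fun i => by rw [h, zero_mulVec]
      simp [this] at htr
    set u := P *ᵥ w with hu
    have hPu : P *ᵥ u = u := by rw [hu, mulVec_mulVec, hid]
    have hpos : 0 < star u ⬝ᵥ u := dotProduct_star_self_pos_iff.mpr hw
    obtain ⟨hre, him⟩ := Complex.pos_iff.mp hpos
    set r := (star u ⬝ᵥ u).re
    have hr : star u ⬝ᵥ u = (r : ℂ) := Complex.ext (by simp [r]) (by simp [← him])
    refine ⟨((Real.sqrt r)⁻¹ : ℂ) • u, ?_, by rw [mulVec_smul, hPu]⟩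
    have hs : ((Real.sqrt r : ℝ) : ℂ) * (Real.sqrt r : ℝ) = r := by
      rw [← Complex.ofReal_mul, Real.mul_self_sqrt hre.le]
    have hs0 : ((Real.sqrt r : ℝ) : ℂ) ≠ 0 := by
      exact_mod_cast (Real.sqrt_pos.mpr hre).ne'
    simp only [star_smul, smul_dotProduct, dotProduct_smul, hr, smul_eq_mul, star_inv₀,
      Complex.star_def, Complex.conj_ofReal]
    rw [← hs]
    field_simp
  have hvP : star v ᵥ* P = star v := by
    conv_lhs => rw [← hH.eq, ← star_mulVec, hPv]
  refine ⟨v, hv, hPv, ?_⟩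
  have hR : (P - vecMulVec v (star v))ᴴ * (P - vecMulVec v (star v))
      = P - vecMulVec v (star v) := by
    rw [conjTranspose_sub, hH.eq, conjTranspose_vecMulVec, star_star, sub_mul, mul_sub, mul_sub,
      hid, mul_vecMulVec, hPv, vecMulVec_mul, hvP, vecMulVec_mul_vecMulVec, hv]
    simp
  rw [← sub_eq_zero, ← trace_conjTranspose_mul_self_eq_zero_iff, hR, trace_sub, htr,
    trace_vecMulVec, dotProduct_comm, hv, sub_self]

/-- A commuting family of elements lifts to a commutative algebra. -/
theorem exists_commRing_lift {ι A : Type*} [Ring A] [Algebra ℂ A] (g : ι → A)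
    (hcomm : ∀ k l, Commute (g k) (g l)) :
    ∃ (S : Subalgebra ℂ A) (_ : ∀ x y : S, x * y = y * x) (g' : ι → S), ∀ k, (g' k : A) = g k := by
  refine ⟨Algebra.adjoin ℂ (Set.range g), fun x y => ?_,
    fun k => ⟨g k, Algebra.subset_adjoin ⟨k, rfl⟩⟩, fun _ => rfl⟩
  have := Algebra.isMulCommutative_adjoin ℂ (s := Set.range g)
    (by rintro _ ⟨k, rfl⟩ _ ⟨l, rfl⟩; exact hcomm k l)
  exact this.is_comm.comm x y

/-- The product of the half-sums `(1 + g k) / 2` over commuting Hermitian involutions. -/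
theorem half_one_add_prod_spec {N : ℕ} {n : Type*} [Fintype n] [DecidableEq n]
    (g : Fin N → Matrix n n ℂ)
    (hherm : ∀ k, (g k).IsHermitian)
    (hsq : ∀ k, g k * g k = 1)
    (hcomm : ∀ k l, Commute (g k) (g l))
    (htr : ∀ T : Finset (Fin N), T.Nonempty →
      (T.noncommProd g fun a _ b _ _ => hcomm a b).trace = 0)
    (P : Matrix n n ℂ)
    (hP : P = (List.ofFn fun k => (2⁻¹ : ℂ) • (1 + g k)).prod) :
    P.IsHermitian ∧ P * P = P ∧ P.trace = (2⁻¹ : ℂ) ^ N * Fintype.card n ∧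
      (∀ k, g k * P = P) ∧ ∀ w : n → ℂ, (∀ k, g k *ᵥ w = w) → P *ᵥ w = w := by
  obtain ⟨S, hS, g', hg'⟩ := exists_commRing_lift g hcomm
  let _ : CommRing S := { (inferInstance : Ring S) with mul_comm := hS }
  let f : S →* Matrix n n ℂ := S.val
  have hfg : ∀ k, f (g' k) = g k := hg'
  let q : Fin N → S := fun k => (2⁻¹ : ℂ) • (1 + g' k)
  have hfq : ∀ k, f (q k) = (2⁻¹ : ℂ) • (1 + g k) := fun k => by
    simp [f, q, hg']
  have hPf : P = f (∏ k, q k) := by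
    rw [hP, ← List.prod_ofFn, map_list_prod, List.map_ofFn]
    congr 2
    funext k
    exact (hfq k).symm
  have hsq' : ∀ k, g' k * g' k = 1 := fun k => Subtype.ext (by simp [hg', hsq])
  have hgq : ∀ k, g' k * q k = q k := fun k => by
    simp only [q, mul_smul_comm, mul_add, mul_one, hsq', add_comm]
  have hqq : ∀ k, q k * q k = q k := fun k => by
    have h : q k * q k = (2⁻¹ : ℂ) • (q k + g' k * q k) := by
      conv_lhs => enter [1]; simp only [q]
      rw [smul_mul_assoc, add_mul, one_mul]
    rw [h, hgq, ← two_smul ℂ (q k), smul_smul]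
    norm_num
  refine ⟨?_, ?_, ?_, fun k => ?_, fun w hw => ?_⟩
  · have key : ∀ s : Finset (Fin N), (f (∏ k ∈ s, q k)).IsHermitian := by
      intro s
      induction s using Finset.induction_on with
      | empty => simp
      | insert a s ha ih =>
        have hq : (f (q a)).IsHermitian := by
          rw [hfq, IsHermitian, conjTranspose_smul, conjTranspose_add, (hherm a).eq]
          simp
        rw [Finset.prod_insert ha, map_mul, IsHermitian, conjTranspose_mul, ih.eq, hq.eq,
          ← map_mul, ← map_mul, mul_comm]
    rw [hPf]
    exact key _
  · rw [hPf, ← map_mul, ← Finset.prod_mul_distrib]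
    simp only [hqq]
  · have hexp : ∏ k, q k = (2⁻¹ : ℂ) ^ N • ∑ T : Finset (Fin N), ∏ k ∈ T, g' k := by
      simp only [q, Finset.prod_smul, Finset.prod_const, Finset.card_univ, Fintype.card_fin,
        Finset.prod_one_add, Finset.powerset_univ]
    have hT : ∀ T : Finset (Fin N), T ≠ ∅ → (f (∏ k ∈ T, g' k)).trace = 0 := by
      intro T hT
      have h := Finset.map_noncommProd T g' (fun _ _ _ _ _ => Commute.all _ _) f
      rw [Finset.noncommProd_eq_prod] at h
      rw [← htr T (Finset.nonempty_iff_ne_empty.mpr hT), h]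
      exact congrArg trace (Finset.noncommProd_congr rfl (fun k _ => hfg k) _)
    have hf : P = (2⁻¹ : ℂ) ^ N • ∑ T : Finset (Fin N), f (∏ k ∈ T, g' k) := by
      rw [hPf, hexp]
      exact (map_smul S.val _ _).trans (congrArg _ (map_sum S.val _ _))
    rw [hf, trace_smul, trace_sum, Finset.sum_eq_single ∅ (fun T _ h => hT T h) (by simp)]
    simp
  · rw [hPf, ← Finset.mul_prod_erase _ _ (Finset.mem_univ k), ← hfg, ← map_mul, ← mul_assoc, hgq]
  · have key : ∀ s : Finset (Fin N), f (∏ k ∈ s, q k) *ᵥ w = w := by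
      intro s
      induction s using Finset.induction_on with
      | empty => simp
      | insert a s ha ih =>
        rw [Finset.prod_insert ha, map_mul, ← mulVec_mulVec, ih, hfq, smul_mulVec, add_mulVec,
          one_mulVec, hw, ← two_smul ℂ w, smul_smul]
        norm_num
    rw [hPf]
    exact key _

/-- **Full-rank stabiliser groups determine a unique pure state.**
If `g 1, …, g N` are Hermitian, squaring to the identity, pairwise commuting
`2^N × 2^N` matrices with all nonempty subset products traceless, then
`P = ∏ k (I + g k)/2` is the rank-one orthogonal projection `v v*` onto a unit vector `v`
which is fixed by all the `g k`, and every common fixed vector is a multiple of `v`. -/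
theorem stmt2 (N : ℕ)
    (g : Fin N → Matrix (Fin (2 ^ N)) (Fin (2 ^ N)) ℂ)
    (hherm : ∀ k, (g k).IsHermitian)
    (hsq : ∀ k, g k * g k = 1)
    (hcomm : ∀ k l, Commute (g k) (g l))
    (htr : ∀ T : Finset (Fin N), T.Nonempty →
      (T.noncommProd g fun a _ b _ _ => hcomm a b).trace = 0)
    (P : Matrix (Fin (2 ^ N)) (Fin (2 ^ N)) ℂ)
    (hP : P = (List.ofFn fun k => (2⁻¹ : ℂ) • (1 + g k)).prod) :
    ∃ v : Fin (2 ^ N) → ℂ,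
      star v ⬝ᵥ v = 1 ∧
      P = Matrix.vecMulVec v (star v) ∧
      (∀ k, g k *ᵥ v = v) ∧
      (∀ w : Fin (2 ^ N) → ℂ, (∀ k, g k *ᵥ w = w) → ∃ c : ℂ, w = c • v) := by
  obtain ⟨hH, hid, hPtr, hgP, hfix⟩ := half_one_add_prod_spec g hherm hsq hcomm htr P hP
  obtain ⟨v, hv, hPv, hvv⟩ := exists_eq_vecMulVec_of_trace_eq_one hH hid
    (by rw [hPtr, Fintype.card_fin, Nat.cast_pow, ← mul_pow]; norm_num)
  refine ⟨v, hv, hvv, fun k => ?_, fun w hw => ⟨star v ⬝ᵥ w, ?_⟩⟩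
  · conv_lhs => rw [← hPv, mulVec_mulVec, hgP, hPv]
  · conv_lhs => rw [← hfix w hw, hvv, vecMulVec_mulVec]
    simp
end

section
/- Let σ₁, σ₂ be 2×2 complex matrices with Tr σ₁ = 0, Tr σ₂ = 0 and Tr(σ₁σ₂) = 0, and let g₁, g₂, ρ′ be arbitrary d × d complex matrices. Then Tr₁[ ((I₂ ⊗ I_d + σ₁ ⊗ g₁)/2) · ((I₂ ⊗ I_d + σ₂ ⊗ g₂)/2) · (I₂ ⊗ (2ρ′)) ] = ρ′, where Tr₁ denotes the partial trace over the first (2-dimensional) tensor factor. -/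
open Matrix
open scoped Kronecker

/-- Partial trace over the first (2-dimensional) tensor factor. -/
noncomputable def ptrace1 {d : ℕ} (M : Matrix (Fin 2 × Fin d) (Fin 2 × Fin d) ℂ) :
    Matrix (Fin d) (Fin d) ℂ :=
  Matrix.of fun j k => ∑ a : Fin 2, M (a, j) (a, k)

theorem ptrace1_add {d : ℕ} (M N : Matrix (Fin 2 × Fin d) (Fin 2 × Fin d) ℂ) :
    ptrace1 (M + N) = ptrace1 M + ptrace1 N := by
  ext j k
  simp [ptrace1, Finset.sum_add_distrib]

theorem ptrace1_smul {d : ℕ} (c : ℂ) (M : Matrix (Fin 2 × Fin d) (Fin 2 × Fin d) ℂ) :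
    ptrace1 (c • M) = c • ptrace1 M := by
  ext j k
  simp [ptrace1, mul_add]

theorem ptrace1_kronecker {d : ℕ} (A : Matrix (Fin 2) (Fin 2) ℂ)
    (B : Matrix (Fin d) (Fin d) ℂ) : ptrace1 (A ⊗ₖ B) = A.trace • B := by
  ext j k
  simp [ptrace1, Matrix.trace, add_mul]

/-- **Partial trace step, two generators.** For `2 × 2` matrices `σ₁, σ₂` with
`Tr σ₁ = Tr σ₂ = Tr (σ₁ σ₂) = 0`,
`Tr₁[((I + σ₁ ⊗ g₁)/2)((I + σ₂ ⊗ g₂)/2)(I₂ ⊗ 2ρ')] = ρ'`. -/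
theorem stmt7 (d : ℕ) (σ₁ σ₂ : Matrix (Fin 2) (Fin 2) ℂ)
    (h₁ : σ₁.trace = 0) (h₂ : σ₂.trace = 0) (h₁₂ : (σ₁ * σ₂).trace = 0)
    (g₁ g₂ ρ' : Matrix (Fin d) (Fin d) ℂ) :
    ptrace1 (((2⁻¹ : ℂ) •
        ((1 : Matrix (Fin 2) (Fin 2) ℂ) ⊗ₖ (1 : Matrix (Fin d) (Fin d) ℂ) + σ₁ ⊗ₖ g₁)) *
      ((2⁻¹ : ℂ) •
        ((1 : Matrix (Fin 2) (Fin 2) ℂ) ⊗ₖ (1 : Matrix (Fin d) (Fin d) ℂ) + σ₂ ⊗ₖ g₂)) *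
      ((1 : Matrix (Fin 2) (Fin 2) ℂ) ⊗ₖ ((2 : ℂ) • ρ'))) = ρ' := by
  simp only [smul_mul_assoc, mul_smul_comm, add_mul, mul_add, ← mul_kronecker_mul, one_mul,
    mul_one, ptrace1_add, ptrace1_smul, ptrace1_kronecker, h₁, h₂, h₁₂,
    Matrix.trace_one, Fintype.card_fin]
  norm_num [smul_smul]
end

section
/- Let N = N_A + N_B and let S be a stabiliser group on N qubits, with the qubits ordered so that each element of S has the form ±(g_A ⊗ g_B) with g_A a Pauli string on the first N_A qubits and g_B a Pauli string on the last N_B qubits. Let ρ = 2^{−N} Σ_{g∈S} g, and let S_A = { h : h is a signed Pauli string on N_A qubits and h ⊗ I_{2^{N_B}} ∈ S }. Then the partial trace of ρ over the B factor satisfies Tr_B ρ = 2^{−N_A} Σ_{h∈S_A} h. -/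
open Matrix
open scoped Kronecker

/-- The Pauli matrix `X`. -/
noncomputable def PauliX : Matrix (Fin 2) (Fin 2) ℂ := !![0, 1; 1, 0]

/-- The Pauli matrix `Y`. -/
noncomputable def PauliY : Matrix (Fin 2) (Fin 2) ℂ := !![0, -Complex.I; Complex.I, 0]

/-- The Pauli matrix `Z`. -/
noncomputable def PauliZ : Matrix (Fin 2) (Fin 2) ℂ := !![1, 0; 0, -1]

/-- The Pauli string `σ 1 ⊗ ⋯ ⊗ σ N`, realised as a matrix indexed by
`Fin N → Fin 2` (the `N`-fold tensor product of `ℂ²`). -/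
noncomputable def PString {N : ℕ} (σ : Fin N → Matrix (Fin 2) (Fin 2) ℂ) :
    Matrix (Fin N → Fin 2) (Fin N → Fin 2) ℂ :=
  Matrix.of fun a b => ∏ i, σ i (a i) (b i)

/-- A signed Pauli string on `N` qubits: `±(σ 1 ⊗ ⋯ ⊗ σ N)` with each `σ i` a Pauli
matrix or the identity. -/
def IsSignedPauli {N : ℕ} (M : Matrix (Fin N → Fin 2) (Fin N → Fin 2) ℂ) : Prop :=
  ∃ (s : ℂ) (σ : Fin N → Matrix (Fin 2) (Fin 2) ℂ),
    (s = 1 ∨ s = -1) ∧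
    (∀ i, σ i ∈ ({1, PauliX, PauliY, PauliZ} : Set (Matrix (Fin 2) (Fin 2) ℂ))) ∧
    M = s • PString σ

/-- Partial trace over the second tensor factor. -/
noncomputable def ptraceB {α β : Type*} [Fintype β]
    (M : Matrix (α × β) (α × β) ℂ) : Matrix α α ℂ :=
  Matrix.of fun j k => ∑ b : β, M (j, b) (k, b)

theorem PString_one (N : ℕ) : PString (fun _ : Fin N => (1 : Matrix (Fin 2) (Fin 2) ℂ)) = 1 := by
  ext a b
  by_cases h : a = b
  · subst h
    simp [PString]
  · obtain ⟨i, hi⟩ := Function.ne_iff.mp h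
    rw [Matrix.one_apply_ne h]
    exact Finset.prod_eq_zero (Finset.mem_univ i) (Matrix.one_apply_ne hi)

theorem trace_PString {N : ℕ} (σ : Fin N → Matrix (Fin 2) (Fin 2) ℂ) :
    (PString σ).trace = ∏ i, (σ i).trace := by
  simp only [Matrix.trace, Matrix.diag, PString, Matrix.of_apply]
  rw [Finset.prod_univ_sum, Fintype.piFinset_univ]

theorem trace_eq_zero_of_pauli_ne_one {M : Matrix (Fin 2) (Fin 2) ℂ}
    (hM : M ∈ ({1, PauliX, PauliY, PauliZ} : Set (Matrix (Fin 2) (Fin 2) ℂ))) (h : M ≠ 1) :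
    M.trace = 0 := by
  simp only [Set.mem_insert_iff, Set.mem_singleton_iff] at hM
  rcases hM with rfl | rfl | rfl | rfl
  · exact absurd rfl h
  all_goals simp [PauliX, PauliY, PauliZ, Matrix.trace_fin_two]

theorem ptraceB_smul {α β : Type*} [Fintype β] (c : ℂ) (M : Matrix (α × β) (α × β) ℂ) :
    ptraceB (c • M) = c • ptraceB M := by
  ext j k
  simp [ptraceB, Finset.mul_sum]

theorem ptraceB_sum {ι α β : Type*} [Fintype β] (s : Finset ι)
    (f : ι → Matrix (α × β) (α × β) ℂ) :
    ptraceB (∑ i ∈ s, f i) = ∑ i ∈ s, ptraceB (f i) := by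
  ext j k
  simp only [ptraceB, Matrix.of_apply, Matrix.sum_apply]
  exact Finset.sum_comm

theorem ptraceB_kronecker {α β : Type*} [Fintype β] (A : Matrix α α ℂ) (B : Matrix β β ℂ) :
    ptraceB (A ⊗ₖ B) = B.trace • A := by
  ext j k
  simp [ptraceB, Matrix.trace, ← Finset.mul_sum, mul_comm]

/-- **Partial trace of a stabiliser state.** Let `S` be a stabiliser group on
`N_A + N_B` qubits (each element a signed Pauli string of the bipartite form
`±(g_A ⊗ g_B)`, forming an abelian group not containing `-1`), with stabiliser state
`ρ = 2^(-N) ∑_{g ∈ S} g`. If `S_A` is the set of signed Pauli strings `h` on the `A`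
qubits with `h ⊗ I ∈ S`, then `Tr_B ρ = 2^(-N_A) ∑_{h ∈ S_A} h`. -/
theorem stmt8 (NA NB : ℕ)
    (S : Finset (Matrix ((Fin NA → Fin 2) × (Fin NB → Fin 2))
      ((Fin NA → Fin 2) × (Fin NB → Fin 2)) ℂ))
    (hone : (1 : Matrix ((Fin NA → Fin 2) × (Fin NB → Fin 2))
      ((Fin NA → Fin 2) × (Fin NB → Fin 2)) ℂ) ∈ S)
    (hmul : ∀ g ∈ S, ∀ h ∈ S, g * h ∈ S)
    (hab : ∀ g ∈ S, ∀ h ∈ S, g * h = h * g)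
    (hpauli : ∀ g ∈ S, ∃ (s : ℂ) (σA : Fin NA → Matrix (Fin 2) (Fin 2) ℂ)
        (σB : Fin NB → Matrix (Fin 2) (Fin 2) ℂ),
        (s = 1 ∨ s = -1) ∧
        (∀ i, σA i ∈ ({1, PauliX, PauliY, PauliZ} : Set (Matrix (Fin 2) (Fin 2) ℂ))) ∧
        (∀ i, σB i ∈ ({1, PauliX, PauliY, PauliZ} : Set (Matrix (Fin 2) (Fin 2) ℂ))) ∧
        g = s • (PString σA ⊗ₖ PString σB))
    (hmone : (-1 : Matrix ((Fin NA → Fin 2) × (Fin NB → Fin 2))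
      ((Fin NA → Fin 2) × (Fin NB → Fin 2)) ℂ) ∉ S)
    (SA : Finset (Matrix (Fin NA → Fin 2) (Fin NA → Fin 2) ℂ))
    (hSA : ∀ h, h ∈ SA ↔ IsSignedPauli h ∧
      h ⊗ₖ (1 : Matrix (Fin NB → Fin 2) (Fin NB → Fin 2) ℂ) ∈ S) :
    ptraceB (((2 : ℂ) ^ (NA + NB))⁻¹ • ∑ g ∈ S, g) =
      ((2 : ℂ) ^ NA)⁻¹ • ∑ h ∈ SA, h := by
  classical
  have htr (h : Matrix (Fin NA → Fin 2) (Fin NA → Fin 2) ℂ) :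
      ptraceB (h ⊗ₖ (1 : Matrix (Fin NB → Fin 2) (Fin NB → Fin 2) ℂ)) = (2 : ℂ) ^ NB • h := by
    simp [ptraceB_kronecker, Matrix.trace_one]
  have hinj : Function.Injective fun h : Matrix (Fin NA → Fin 2) (Fin NA → Fin 2) ℂ =>
      h ⊗ₖ (1 : Matrix (Fin NB → Fin 2) (Fin NB → Fin 2) ℂ) := fun h h' e =>
    smul_right_injective _ (pow_ne_zero NB (two_ne_zero (α := ℂ)))
      ((htr h).symm.trans ((congrArg ptraceB e).trans (htr h')))
  have hsub : SA.image (fun h => h ⊗ₖ (1 : Matrix (Fin NB → Fin 2) (Fin NB → Fin 2) ℂ)) ⊆ S := by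
    intro g hg
    obtain ⟨h, hh, rfl⟩ := Finset.mem_image.mp hg
    exact ((hSA h).mp hh).2
  have hsum : ∑ g ∈ S, ptraceB g = (2 : ℂ) ^ NB • ∑ h ∈ SA, h := by
    rw [← Finset.sum_subset hsub, Finset.sum_image hinj.injOn, Finset.smul_sum]
    · exact Finset.sum_congr rfl fun h _ => htr h
    · intro g hg hg'
      obtain ⟨s, σA, σB, hs, hA, hB, rfl⟩ := hpauli g hg
      by_cases hσ : ∀ i, σB i = 1
      · obtain rfl : σB = fun _ => 1 := funext hσ
        rw [PString_one, ← Matrix.smul_kronecker] at hg hg'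
        exact absurd (Finset.mem_image_of_mem _ ((hSA _).mpr ⟨⟨s, σA, hs, hA, rfl⟩, hg⟩)) hg'
      · obtain ⟨i, hi⟩ := not_forall.mp hσ
        rw [ptraceB_smul, ptraceB_kronecker, trace_PString,
          Finset.prod_eq_zero (Finset.mem_univ i) (trace_eq_zero_of_pauli_ne_one (hB i) hi),
          zero_smul, smul_zero]
  rw [ptraceB_smul, ptraceB_sum, hsum, smul_smul, pow_add, mul_inv, mul_assoc,
    inv_mul_cancel₀ (pow_ne_zero NB two_ne_zero), mul_one]
end

section
/- Let g_1, …, g_K be 2^N × 2^N matrices, each of the form g_k = s_k (σ_{k,1} ⊗ ⋯ ⊗ σ_{k,N}) with s_k ∈ {1, −1} and every σ_{k,i} ∈ {I₂, X}. Then P := ∏_{k=1}^K (I + g_k)/2 can be written as P = Σ_{b ∈ {0,1}^N} λ_b e_b e_b* with coefficients λ_b ∈ {0, 1}, where e_b = v_{b_1} ⊗ ⋯ ⊗ v_{b_N}, v_0 = (1,1)ᵀ/√2, v_1 = (1,−1)ᵀ/√2. Consequently, whenever Tr P > 0, the normalized state P / Tr P is a convex combination of projections onto Kronecker products of single-qubit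 vectors, and hence is separable with respect to every bipartition of the qubits. -/
open Matrix
open scoped Kronecker ComplexOrder

/-- The single-qubit Hadamard basis vectors: `hvec 0 = (1,1)ᵀ/√2`, `hvec 1 = (1,-1)ᵀ/√2`. -/
noncomputable def hvec : Fin 2 → Fin 2 → ℂ :=
  fun b a => (if b = 1 ∧ a = 1 then -1 else 1) * ((Real.sqrt 2 : ℝ) : ℂ)⁻¹

/-- The `N`-qubit Hadamard basis vector `e_b = hvec b₁ ⊗ ⋯ ⊗ hvec b_N`. -/
noncomputable def ebv {N : ℕ} (b : Fin N → Fin 2) : (Fin N → Fin 2) → ℂ :=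
  fun a => ∏ i, hvec (b i) (a i)

/-- Separability of a bipartite state: a finite convex combination of Kronecker
products of density matrices. -/
def Separable {α β : Type*} [Fintype α] [Fintype β]
    (ρ : Matrix (α × β) (α × β) ℂ) : Prop :=
  ∃ (m : ℕ) (w : Fin m → ℝ) (A : Fin m → Matrix α α ℂ) (B : Fin m → Matrix β β ℂ),
    (∀ i, 0 ≤ w i) ∧ (∑ i, w i) = 1 ∧
    (∀ i, (A i).PosSemidef ∧ (A i).trace = 1) ∧
    (∀ i, (B i).PosSemidef ∧ (B i).trace = 1) ∧
    ρ = ∑ i, (w i : ℂ) • (A i ⊗ₖ B i)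

/-- The canonical identification of the `N`-qubit Hilbert space with the tensor product
of the qubits in `A` and those outside `A`. -/
def bipartition {N : ℕ} (A : Finset (Fin N)) :
    (Fin N → Fin 2) ≃ ({x // x ∈ A} → Fin 2) × ({x // x ∉ A} → Fin 2) :=
  Equiv.piEquivPiSubtypeProd (fun i => i ∈ A) (fun _ => Fin 2)

/-- The tensor product of Hadamard basis vectors over an arbitrary finite set of qubits. -/
noncomputable def hadamardVec {ι : Type*} [Fintype ι] (b : ι → Fin 2) : (ι → Fin 2) → ℂ :=
  fun a => ∏ i, hvec (b i) (a i)

lemma inv_sqrt_two_mul_self :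
    ((Real.sqrt 2 : ℝ) : ℂ)⁻¹ * ((Real.sqrt 2 : ℝ) : ℂ)⁻¹ = 2⁻¹ := by
  rw [← mul_inv, ← Complex.ofReal_mul, Real.mul_self_sqrt (by norm_num)]
  norm_num

lemma star_hvec (b a : Fin 2) : star (hvec b a) = hvec b a := by
  unfold hvec
  split_ifs <;> simp

lemma sum_hvec_mul_hvec_left (a c : Fin 2) :
    ∑ b, hvec b a * hvec b c = if a = c then 1 else 0 := by
  have h := inv_sqrt_two_mul_self
  fin_cases a <;> fin_cases c <;> simp [hvec, Fin.sum_univ_two, h]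
  all_goals norm_num

lemma sum_hvec_mul_self (b : Fin 2) : ∑ a, hvec b a * hvec b a = 1 := by
  have h := inv_sqrt_two_mul_self
  fin_cases b <;> simp [hvec, Fin.sum_univ_two, h]
  all_goals norm_num

lemma star_hadamardVec {ι : Type*} [Fintype ι] (b : ι → Fin 2) :
    star (hadamardVec b) = hadamardVec b := by
  ext a
  simp only [hadamardVec, Pi.star_apply, star_prod, star_hvec]

lemma sum_vecMulVec_hadamardVec {ι : Type*} [Fintype ι] [DecidableEq ι] :
    ∑ b : ι → Fin 2, vecMulVec (hadamardVec b) (star (hadamardVec b)) = 1 := by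
  ext a c
  simp only [star_hadamardVec, Matrix.sum_apply, vecMulVec_apply, hadamardVec,
    ← Finset.prod_mul_distrib]
  rw [← Fintype.piFinset_univ, ← Finset.prod_univ_sum (fun _ => Finset.univ)
    (fun i β => hvec β (a i) * hvec β (c i))]
  simp only [sum_hvec_mul_hvec_left, Matrix.one_apply]
  rw [Finset.prod_ite_zero]
  simp [funext_iff]

lemma trace_vecMulVec_hadamardVec {ι : Type*} [Fintype ι] [DecidableEq ι] (b : ι → Fin 2) :
    (vecMulVec (hadamardVec b) (star (hadamardVec b))).trace = 1 := by
  simp only [star_hadamardVec, Matrix.trace, Matrix.diag, vecMulVec_apply, hadamardVec,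
    ← Finset.prod_mul_distrib]
  rw [← Fintype.piFinset_univ, ← Finset.prod_univ_sum (fun _ => Finset.univ)
    (fun i α => hvec (b i) α * hvec (b i) α)]
  simp only [sum_hvec_mul_self, Finset.prod_const_one]

lemma exists_sign_mulVec_hvec {M : Matrix (Fin 2) (Fin 2) ℂ} (hM : M = 1 ∨ M = PauliX)
    (b : Fin 2) : ∃ t : ℂ, (t = 1 ∨ t = -1) ∧ M *ᵥ hvec b = t • hvec b := by
  rcases hM with rfl | rfl
  · exact ⟨1, Or.inl rfl, by simp⟩
  · refine ⟨if b = 1 then -1 else 1, by split_ifs <;> simp, ?_⟩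
    ext a
    fin_cases b <;> fin_cases a <;> simp [PauliX, hvec, Matrix.mulVec, dotProduct]

lemma PString_mulVec_ebv {N : ℕ} (σ : Fin N → Matrix (Fin 2) (Fin 2) ℂ) (b : Fin N → Fin 2) :
    PString σ *ᵥ ebv b = fun a => ∏ i, (σ i *ᵥ hvec (b i)) (a i) := by
  ext a
  simp only [Matrix.mulVec, dotProduct, PString, ebv, Matrix.of_apply, ← Finset.prod_mul_distrib]
  rw [← Fintype.piFinset_univ, ← Finset.prod_univ_sum (fun _ => Finset.univ)
    (fun i β => σ i (a i) β * hvec (b i) β)]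

lemma prod_eq_one_or_neg_one {ι : Type*} (s : Finset ι) {t : ι → ℂ}
    (ht : ∀ i, t i = 1 ∨ t i = -1) : ∏ i ∈ s, t i = 1 ∨ ∏ i ∈ s, t i = -1 := by
  refine Finset.prod_induction t (fun z => z = 1 ∨ z = -1) ?_ (Or.inl rfl) fun i _ => ht i
  rintro _ _ (rfl | rfl) (rfl | rfl) <;> simp

lemma exists_sign_PString_mulVec_ebv {N : ℕ} {σ : Fin N → Matrix (Fin 2) (Fin 2) ℂ}
    (hσ : ∀ i, σ i = 1 ∨ σ i = PauliX) (b : Fin N → Fin 2) :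
    ∃ t : ℂ, (t = 1 ∨ t = -1) ∧ PString σ *ᵥ ebv b = t • ebv b := by
  choose t ht htσ using fun i => exists_sign_mulVec_hvec (hσ i) (b i)
  refine ⟨∏ i, t i, prod_eq_one_or_neg_one _ ht, ?_⟩
  rw [PString_mulVec_ebv]
  ext a
  simp [htσ, ebv, Finset.prod_mul_distrib]

lemma List.exists_zero_or_one_prod_mulVec {n : Type*} [Fintype n] [DecidableEq n] (v : n → ℂ)
    (L : List (Matrix n n ℂ)) (hL : ∀ M ∈ L, ∃ c : ℂ, (c = 0 ∨ c = 1) ∧ M *ᵥ v = c • v) :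
    ∃ c : ℂ, (c = 0 ∨ c = 1) ∧ L.prod *ᵥ v = c • v := by
  induction L with
  | nil => exact ⟨1, Or.inr rfl, by simp⟩
  | cons M L ih =>
    obtain ⟨c, hc, hcv⟩ := ih fun M' hM' => hL M' (List.mem_cons_of_mem _ hM')
    obtain ⟨d, hd, hdv⟩ := hL M List.mem_cons_self
    refine ⟨c * d, by rcases hc with rfl | rfl <;> simp [hd], ?_⟩
    rw [List.prod_cons, ← Matrix.mulVec_mulVec, hcv, Matrix.mulVec_smul, hdv, smul_smul]

lemma Separable.of_fintype {α β κ : Type*} [Fintype α] [Fintype β] [Fintype κ]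
    {ρ : Matrix (α × β) (α × β) ℂ} (w : κ → ℝ) (A : κ → Matrix α α ℂ) (B : κ → Matrix β β ℂ)
    (hw : ∀ k, 0 ≤ w k) (hsum : ∑ k, w k = 1)
    (hA : ∀ k, (A k).PosSemidef ∧ (A k).trace = 1)
    (hB : ∀ k, (B k).PosSemidef ∧ (B k).trace = 1)
    (hρ : ρ = ∑ k, (w k : ℂ) • (A k ⊗ₖ B k)) : Separable ρ := by
  let e := (Fintype.equivFin κ).symm
  refine ⟨Fintype.card κ, w ∘ e, A ∘ e, B ∘ e, fun _ => hw _, ?_, fun _ => hA _,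
    fun _ => hB _, ?_⟩
  · rw [← hsum]
    exact e.sum_comp w
  · rw [hρ]
    exact (e.sum_comp fun k => (w k : ℂ) • (A k ⊗ₖ B k)).symm

lemma reindex_vecMulVec_ebv {N : ℕ} (A : Finset (Fin N)) (b : Fin N → Fin 2) :
    Matrix.reindex (bipartition A) (bipartition A) (vecMulVec (ebv b) (star (ebv b))) =
      vecMulVec (hadamardVec (bipartition A b).1) (star (hadamardVec (bipartition A b).1)) ⊗ₖ
      vecMulVec (hadamardVec (bipartition A b).2) (star (hadamardVec (bipartition A b).2)) := by
  have key (x) : ebv b ((bipartition A).symm x) =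
      hadamardVec (bipartition A b).1 x.1 * hadamardVec (bipartition A b).2 x.2 := by
    obtain ⟨a, rfl⟩ := (bipartition A).surjective x
    rw [Equiv.symm_apply_apply]
    change ∏ i, hvec (b i) (a i) = (∏ i : {x // x ∈ A}, hvec (b i) (a i)) *
      ∏ i : {x // x ∉ A}, hvec (b i) (a i)
    convert (Fintype.prod_subtype_mul_prod_subtype (fun i => i ∈ A)
      fun i => hvec (b i) (a i)).symm
  ext x y
  simp only [Matrix.reindex_apply, Matrix.submatrix_apply, vecMulVec_apply, Pi.star_apply, key,
    Matrix.kroneckerMap_apply, star_mul']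
  ring

lemma separable_reindex_of_eq_sum {N : ℕ} {P : Matrix (Fin N → Fin 2) (Fin N → Fin 2) ℂ}
    {lam : (Fin N → Fin 2) → ℂ} (hlam : ∀ b, lam b = 0 ∨ lam b = 1)
    (hP : P = ∑ b, lam b • vecMulVec (ebv b) (star (ebv b))) (htr : P.trace ≠ 0)
    (A : Finset (Fin N)) :
    Separable (Matrix.reindex (bipartition A) (bipartition A) ((P.trace)⁻¹ • P)) := by
  obtain ⟨r, rfl, hr⟩ : ∃ r : (Fin N → Fin 2) → ℝ, lam = (fun b => (r b : ℂ)) ∧ ∀ b, 0 ≤ r b := by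
    refine ⟨fun b => (lam b).re, funext fun b => ?_, fun b => ?_⟩ <;>
      rcases hlam b with h | h <;> simp [h]
  have htrace : P.trace = ((∑ b, r b : ℝ) : ℂ) := by
    rw [hP, Matrix.trace_sum, Complex.ofReal_sum]
    refine Finset.sum_congr rfl fun b _ => ?_
    rw [Matrix.trace_smul, show ebv b = hadamardVec b from rfl, trace_vecMulVec_hadamardVec,
      smul_eq_mul, mul_one]
  have hne : ∑ b, r b ≠ 0 := fun h => htr (by rw [htrace, h, Complex.ofReal_zero])
  refine Separable.of_fintype (κ := Fin N → Fin 2) (fun b => (∑ b, r b)⁻¹ * r b)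
    (fun b => vecMulVec (hadamardVec (bipartition A b).1)
      (star (hadamardVec (bipartition A b).1)))
    (fun b => vecMulVec (hadamardVec (bipartition A b).2)
      (star (hadamardVec (bipartition A b).2)))
    (fun b => mul_nonneg (inv_nonneg.2 (Finset.sum_nonneg fun b _ => hr b)) (hr b))
    (by rw [← Finset.mul_sum, inv_mul_cancel₀ hne])
    (fun b => ⟨Matrix.posSemidef_vecMulVec_self_star _, trace_vecMulVec_hadamardVec _⟩)
    (fun b => ⟨Matrix.posSemidef_vecMulVec_self_star _, trace_vecMulVec_hadamardVec _⟩) ?_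
  simp only [← reindex_vecMulVec_ebv]
  rw [htrace, hP]
  ext x y
  simp [Matrix.sum_apply, Finset.mul_sum, mul_assoc]

/-- **Stabiliser states with `X`/`I` generators are diagonal in the Hadamard basis,
hence separable.** If every `g k` is `± (σ_{k,1} ⊗ ⋯ ⊗ σ_{k,N})` with all `σ_{k,i}` equal
to `I₂` or `X`, then `P = ∏ k (I + g k)/2` equals `∑_b λ_b e_b e_b*` with `λ_b ∈ {0,1}`;
consequently, if `Tr P ≠ 0`, the normalized state `P / Tr P` is separable with respect to
every bipartition of the qubits. -/
theorem stmt11 (N K : ℕ)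
    (g : Fin K → Matrix (Fin N → Fin 2) (Fin N → Fin 2) ℂ)
    (hg : ∀ k, ∃ (s : ℂ) (σ : Fin N → Matrix (Fin 2) (Fin 2) ℂ),
      (s = 1 ∨ s = -1) ∧ (∀ i, σ i = 1 ∨ σ i = PauliX) ∧ g k = s • PString σ)
    (P : Matrix (Fin N → Fin 2) (Fin N → Fin 2) ℂ)
    (hP : P = (List.ofFn fun k => (2⁻¹ : ℂ) • (1 + g k)).prod) :
    (∃ lam : (Fin N → Fin 2) → ℂ, (∀ b, lam b = 0 ∨ lam b = 1) ∧
      P = ∑ b : Fin N → Fin 2, lam b • Matrix.vecMulVec (ebv b) (star (ebv b))) ∧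
    (P.trace ≠ 0 → ∀ A : Finset (Fin N),
      Separable (Matrix.reindex (bipartition A) (bipartition A) ((P.trace)⁻¹ • P))) := by
  have hdiag : ∀ b : Fin N → Fin 2, ∃ c : ℂ, (c = 0 ∨ c = 1) ∧ P *ᵥ ebv b = c • ebv b := by
    intro b
    rw [hP]
    refine List.exists_zero_or_one_prod_mulVec _ _ fun M hM => ?_
    obtain ⟨k, rfl⟩ := (List.mem_ofFn' _ _).1 hM
    obtain ⟨s, σ, hs, hσ, hgk⟩ := hg k
    obtain ⟨t, ht, htσ⟩ := exists_sign_PString_mulVec_ebv hσ b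
    refine ⟨2⁻¹ * (1 + s * t), ?_, ?_⟩
    · rcases hs with rfl | rfl <;> rcases ht with rfl | rfl <;> norm_num
    · beta_reduce
      rw [hgk, Matrix.smul_mulVec, Matrix.add_mulVec, Matrix.one_mulVec, Matrix.smul_mulVec, htσ,
        mul_smul, add_smul, one_smul, mul_smul]
  choose lam hlam hlamP using hdiag
  have hsum : P = ∑ b, lam b • vecMulVec (ebv b) (star (ebv b)) := by
    calc P = P * ∑ b, vecMulVec (ebv b) (star (ebv b)) := by
          rw [show ∑ b, vecMulVec (ebv b) (star (ebv b)) = (1 : Matrix (Fin N → Fin 2) _ ℂ) from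
            sum_vecMulVec_hadamardVec, mul_one]
      _ = _ := by
          rw [Matrix.mul_sum]
          refine Finset.sum_congr rfl fun b _ => ?_
          rw [Matrix.mul_vecMulVec, hlamP, Matrix.smul_vecMulVec]
  exact ⟨⟨lam, hlam, hsum⟩, fun htr A => separable_reindex_of_eq_sum hlam hsum htr A⟩
end

section
/- Let s, t ∈ {1, −1}, and let Q₁, Q₂, g′ be arbitrary d × d complex matrices. Set A = (I₂ + sX)/2, P₁ = A ⊗ Q₁ and P₂ = ((I₂ ⊗ I_d + t (X ⊗ g′))/2) · (I₂ ⊗ Q₂). Then P₁ P₂ P₁ = A ⊗ ( Q₁ · ((I_d + s t g′)/2) · Q₂ · Q₁ ). -/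
open Matrix
open scoped Kronecker

/-- The matrix `(1 + s X) / 2` is idempotent when `s ^ 2 = 1`. -/
theorem half_one_add_smul_PauliX_mul_self {s : ℂ} (hs : s * s = 1) :
    ((2⁻¹ : ℂ) • (1 + s • PauliX)) * ((2⁻¹ : ℂ) • (1 + s • PauliX)) =
      (2⁻¹ : ℂ) • (1 + s • PauliX) := by
  ext i j
  fin_cases i <;> fin_cases j <;>
    simp [PauliX, Matrix.mul_apply, Fin.sum_univ_two] <;> grind

/-- The matrix `(1 + s X) / 2` absorbs `X` on the right with eigenvalue `s` when `s ^ 2 = 1`. -/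
theorem half_one_add_smul_PauliX_mul_PauliX {s : ℂ} (hs : s * s = 1) :
    ((2⁻¹ : ℂ) • (1 + s • PauliX)) * PauliX = s • ((2⁻¹ : ℂ) • (1 + s • PauliX)) := by
  ext i j
  fin_cases i <;> fin_cases j <;>
    simp [PauliX, Matrix.mul_apply, Fin.sum_univ_two] <;> grind

/-- **Overlap iteration step, case (b) with `σ = X`.** With `A = (I₂ + sX)/2`,
`P₁ = A ⊗ Q₁` and `P₂ = ((I + t(X ⊗ g'))/2)(I₂ ⊗ Q₂)`,
`P₁ P₂ P₁ = A ⊗ (Q₁ ((I + st g')/2) Q₂ Q₁)`. -/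
theorem stmt16 (d : ℕ) (s t : ℂ) (hs : s = 1 ∨ s = -1) (ht : t = 1 ∨ t = -1)
    (Q₁ Q₂ g' : Matrix (Fin d) (Fin d) ℂ)
    (A : Matrix (Fin 2) (Fin 2) ℂ) (hA : A = (2⁻¹ : ℂ) • (1 + s • PauliX))
    (P₁ P₂ : Matrix (Fin 2 × Fin d) (Fin 2 × Fin d) ℂ)
    (hP₁ : P₁ = A ⊗ₖ Q₁)
    (hP₂ : P₂ = ((2⁻¹ : ℂ) •
        ((1 : Matrix (Fin 2) (Fin 2) ℂ) ⊗ₖ (1 : Matrix (Fin d) (Fin d) ℂ) +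
          t • (PauliX ⊗ₖ g'))) *
      ((1 : Matrix (Fin 2) (Fin 2) ℂ) ⊗ₖ Q₂)) :
    P₁ * P₂ * P₁ =
      A ⊗ₖ (Q₁ * ((2⁻¹ : ℂ) • (1 + (s * t) • g')) * Q₂ * Q₁) := by
  have hss : s * s = 1 := by rcases hs with rfl | rfl <;> norm_num
  have hAA : A * A = A := hA ▸ half_one_add_smul_PauliX_mul_self hss
  have hAX : A * PauliX = s • A := hA ▸ half_one_add_smul_PauliX_mul_PauliX hss
  subst hP₁ hP₂
  simp only [Matrix.mul_add, Matrix.add_mul, Matrix.mul_smul, Matrix.smul_mul,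
    ← Matrix.mul_kronecker_mul, Matrix.mul_one, Matrix.one_mul, hAX, hAA,
    Matrix.kronecker_add, Matrix.kronecker_smul, Matrix.smul_kronecker, smul_add, smul_smul,
    Matrix.mul_assoc]
  congr 2
  ring
end

section
/- Let s, t ∈ {1, −1}, let σ be a 2×2 complex matrix with X σ = −σ X, and let Q₁, Q₂, g′ be arbitrary d × d complex matrices. Set A = (I₂ + sX)/2, P₁ = A ⊗ Q₁ and P₂ = ((I₂ ⊗ I_d + t (σ ⊗ g′))/2) · (I₂ ⊗ Q₂). Then P₁ P₂ P₁ = (1/2) · A ⊗ (Q₁ Q₂ Q₁). -/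
open Matrix
open scoped Kronecker

theorem PauliX_mul_self : PauliX * PauliX = 1 := by
  simp [PauliX, Matrix.one_fin_two]

/-- Compressing a matrix anticommuting with `X` by `(1 + s • X) / 2` gives zero when
`s ^ 2 = 1`. -/
theorem half_one_add_smul_PauliX_mul_mul_eq_zero {s : ℂ} (hs : s * s = 1)
    {σ : Matrix (Fin 2) (Fin 2) ℂ} (hσ : PauliX * σ = -(σ * PauliX)) :
    ((2⁻¹ : ℂ) • (1 + s • PauliX)) * σ * ((2⁻¹ : ℂ) • (1 + s • PauliX)) = 0 := by
  have hXσX : σ * PauliX * PauliX = σ := by rw [mul_assoc, PauliX_mul_self, mul_one]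
  simp only [smul_mul_assoc, mul_smul_comm, add_mul, mul_add, one_mul, mul_one,
    hσ, neg_mul, hXσX, smul_smul, smul_neg]
  match_scalars
  · linear_combination -hs / 4
  · ring

/-- **Overlap iteration step, case (b) with `σ ≠ X`.** With `A = (I₂ + sX)/2`,
`σ` anticommuting with `X`, `P₁ = A ⊗ Q₁` and `P₂ = ((I + t(σ ⊗ g'))/2)(I₂ ⊗ Q₂)`,
`P₁ P₂ P₁ = (1/2) A ⊗ (Q₁ Q₂ Q₁)`. -/
theorem stmt17 (d : ℕ) (s t : ℂ) (hs : s = 1 ∨ s = -1) (ht : t = 1 ∨ t = -1)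
    (σ : Matrix (Fin 2) (Fin 2) ℂ) (hσ : PauliX * σ = -(σ * PauliX))
    (Q₁ Q₂ g' : Matrix (Fin d) (Fin d) ℂ)
    (A : Matrix (Fin 2) (Fin 2) ℂ) (hA : A = (2⁻¹ : ℂ) • (1 + s • PauliX))
    (P₁ P₂ : Matrix (Fin 2 × Fin d) (Fin 2 × Fin d) ℂ)
    (hP₁ : P₁ = A ⊗ₖ Q₁)
    (hP₂ : P₂ = ((2⁻¹ : ℂ) •
        ((1 : Matrix (Fin 2) (Fin 2) ℂ) ⊗ₖ (1 : Matrix (Fin d) (Fin d) ℂ) +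
          t • (σ ⊗ₖ g'))) *
      ((1 : Matrix (Fin 2) (Fin 2) ℂ) ⊗ₖ Q₂)) :
    P₁ * P₂ * P₁ = (2⁻¹ : ℂ) • (A ⊗ₖ (Q₁ * Q₂ * Q₁)) := by
  have hs2 : s * s = 1 := by rcases hs with rfl | rfl <;> norm_num
  have hAA : A * A = A := hA ▸ half_one_add_smul_PauliX_mul_self hs2
  have hAσA : A * σ * A = 0 := hA ▸ half_one_add_smul_PauliX_mul_mul_eq_zero hs2 hσ
  subst hP₁ hP₂
  simp only [smul_mul_assoc, mul_smul_comm, add_mul, mul_add, ← Matrix.mul_kronecker_mul,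
    one_mul, mul_one, hAA, hAσA, Matrix.zero_kronecker, smul_zero, add_zero]
end
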